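/- arXiv:1808.05389 — 3 statements merged into one kernel-verified Lean document; each statement's English description precedes it below -/
import Mathlib

section
/- There exists a constant C > 0 such that the following holds for every n ≥ 2 and every initial load vector ℓ⁰ ∈ ℕⁿ with initial discrepancy Δ = maxᵢ ℓ⁰ᵢ − minᵢ ℓ⁰ᵢ ≥ 1: letting t = ⌈C·n·(log n + log Δ)⌉, the probability under the t-fold iterate of the one-step balancing kernel started from ℓ⁰ that every node's load lies in {⌊ā⌉−1, ⌊ā⌉, ⌊ā⌉+1} is at least 1 − C/n. -/
open scoped BigOperators

/-- `balance ℓ u v` replaces `ℓ u` by `⌈(ℓ u + ℓ v)/2⌉` and `ℓ v` by `⌊(ℓ u + ℓ v)/2⌋`. -/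
noncomputable def balance {n : ℕ} (ℓ : Fin n → ℤ) (u v : Fin n) : Fin n → ℤ :=
  fun i =>
    if i = u then ⌈(((ℓ u + ℓ v : ℤ) : ℚ)) / 2⌉
    else if i = v then ⌊(((ℓ u + ℓ v : ℤ) : ℚ)) / 2⌋
    else ℓ i

/-- The one-step balancing kernel: from state `ℓ`, pick an ordered pair `(u, v)` of distinct
nodes uniformly at random (each with probability `1/(n(n−1))`) and move to `balance ℓ u v`. -/
noncomputable def stepPMF {n : ℕ} (hn : 2 ≤ n) (ℓ : Fin n → ℤ) : PMF (Fin n → ℤ) :=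
  (PMF.uniformOfFinset
      (Finset.univ.filter (fun p : Fin n × Fin n => p.1 ≠ p.2))
      ⟨(⟨0, by omega⟩, ⟨1, by omega⟩), by
        simp [Finset.mem_filter, Fin.ext_iff]⟩).map
    (fun p => balance ℓ p.1 p.2)

/-- The distribution of the load vector after `t` steps of the balancing process
started from `ℓ0`. -/
noncomputable def iterPMF {n : ℕ} (hn : 2 ≤ n) (ℓ0 : Fin n → ℤ) : ℕ → PMF (Fin n → ℤ)
  | 0 => PMF.pure ℓ0
  | (t + 1) => (iterPMF hn ℓ0 t).bind (stepPMF hn)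

open Finset

/-- The convex potential `z² - |z|` of a single deviation; it vanishes exactly on `{-1, 0, 1}`. -/
def nodePotential (z : ℤ) : ℤ := z * z - |z|

/-- The decrease of the potential when nodes with deviations `x` and `y` are balanced. -/
def potentialDrop (x y : ℤ) : ℤ :=
  nodePotential x + nodePotential y - nodePotential ((x + y + 1) / 2) - nodePotential ((x + y) / 2)

/-- The total potential of a load vector with respect to the reference load `r`. -/
def totalPotential {n : ℕ} (r : ℤ) (ℓ : Fin n → ℤ) : ℤ := ∑ i, nodePotential (ℓ i - r)

lemma nodePotential_neg (z : ℤ) : nodePotential (-z) = nodePotential z := by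
  simp [nodePotential]

lemma nodePotential_nonneg (z : ℤ) : 0 ≤ nodePotential z := by
  unfold nodePotential
  have h : |z| * |z| = z * z := abs_mul_abs_self z
  have h0 := abs_nonneg z
  rcases h0.eq_or_lt with h1 | h1 <;> nlinarith

lemma one_le_nodePotential {z : ℤ} (hz : 2 ≤ |z|) : 1 ≤ nodePotential z := by
  unfold nodePotential
  have h : |z| * |z| = z * z := abs_mul_abs_self z
  nlinarith

lemma totalPotential_nonneg {n : ℕ} (r : ℤ) (ℓ : Fin n → ℤ) : 0 ≤ totalPotential r ℓ :=
  sum_nonneg fun _ _ => nodePotential_nonneg _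

lemma potentialDrop_comm (x y : ℤ) : potentialDrop x y = potentialDrop y x := by
  unfold potentialDrop
  rw [add_comm y x]
  ring

lemma potentialDrop_self (x : ℤ) : potentialDrop x x = 0 := by
  unfold potentialDrop
  rw [show (x + x + 1) / 2 = x by omega, show (x + x) / 2 = x by omega]
  ring

lemma potentialDrop_neg (x y : ℤ) : potentialDrop (-x) (-y) = potentialDrop x y := by
  unfold potentialDrop
  rw [show (-x + -y + 1) / 2 = -((x + y) / 2) by omega,
    show (-x + -y) / 2 = -((x + y + 1) / 2) by omega]
  simp only [nodePotential_neg]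
  ring

/-- Every integer pair sum splits into two rounded halves. -/
lemma exists_halves (x y : ℤ) : ∃ p q : ℤ, (x + y + 1) / 2 = p ∧ (x + y) / 2 = q ∧
    p + q = x + y ∧ (p = q ∨ p = q + 1) :=
  ⟨_, _, rfl, rfl, by omega, by omega⟩

lemma le_two_mul_potentialDrop_of_nonneg {x y : ℤ} (hx : 0 ≤ x) (hy : 0 ≤ y) :
    (x - y) * (x - y) - 1 ≤ 2 * potentialDrop x y := by
  obtain ⟨p, q, hp, hq, hs, h⟩ := exists_halves x y
  have hp0 : 0 ≤ p := by omega
  have hq0 : 0 ≤ q := by omega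
  unfold potentialDrop nodePotential
  rw [hp, hq, abs_of_nonneg hx, abs_of_nonneg hy, abs_of_nonneg hp0, abs_of_nonneg hq0]
  obtain rfl : x = p + q - y := by omega
  rcases h with rfl | rfl <;> nlinarith

lemma potentialDrop_nonneg_of_nonneg {x y : ℤ} (hx : 0 ≤ x) (hy : 0 ≤ y) :
    0 ≤ potentialDrop x y := by
  have := le_two_mul_potentialDrop_of_nonneg hx hy
  have := mul_self_nonneg (x - y)
  omega

lemma nodePotential_add_le_of_add_nonneg {x y : ℤ} (hx : 0 ≤ x) (hy : y ≤ 0) (hxy : 0 ≤ x + y) :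
    nodePotential x + nodePotential y ≤ 2 * potentialDrop x y := by
  obtain ⟨p, q, hp, hq, hs, h⟩ := exists_halves x y
  have hp0 : 0 ≤ p := by omega
  have hq0 : 0 ≤ q := by omega
  unfold potentialDrop nodePotential
  rw [hp, hq, abs_of_nonneg hx, abs_of_nonpos hy, abs_of_nonneg hp0, abs_of_nonneg hq0]
  obtain ⟨b, rfl⟩ : ∃ b, y = -b := ⟨-y, by ring⟩
  have hb : 0 ≤ b := by omega
  rcases h with rfl | rfl
  · obtain rfl : x = p + p + b := by omega
    rcases hb.eq_or_lt with rfl | hb <;> nlinarith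
  · obtain rfl : x = q + 1 + q + b := by omega
    rcases hb.eq_or_lt with rfl | hb <;> nlinarith

lemma nodePotential_add_le {x y : ℤ} (hx : 0 ≤ x) (hy : y ≤ 0) :
    nodePotential x + nodePotential y ≤ 2 * potentialDrop x y := by
  rcases le_total 0 (x + y) with h | h
  · exact nodePotential_add_le_of_add_nonneg hx hy h
  · have := nodePotential_add_le_of_add_nonneg (x := -y) (y := -x) (by omega) (by omega) (by omega)
    rw [potentialDrop_neg, potentialDrop_comm, nodePotential_neg, nodePotential_neg] at this
    omega

lemma nodePotential_le {x y : ℤ} (h : 0 ≤ x ∧ y ≤ 0 ∨ x ≤ 0 ∧ 0 ≤ y) :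
    nodePotential x ≤ 2 * potentialDrop x y := by
  have hy := nodePotential_nonneg y
  rcases h with ⟨h1, h2⟩ | ⟨h1, h2⟩
  · linarith [nodePotential_add_le h1 h2]
  · linarith [nodePotential_add_le h2 h1, potentialDrop_comm x y]

lemma potentialDrop_nonneg (x y : ℤ) : 0 ≤ potentialDrop x y := by
  have hx := nodePotential_nonneg x
  rcases le_total 0 x with h1 | h1 <;> rcases le_total 0 y with h2 | h2
  · exact potentialDrop_nonneg_of_nonneg h1 h2
  · linarith [nodePotential_le (x := x) (y := y) (by tauto)]
  · linarith [nodePotential_le (x := x) (y := y) (by tauto)]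
  · rw [← potentialDrop_neg]
    exact potentialDrop_nonneg_of_nonneg (by omega) (by omega)

/-- The sum of all squared differences over ordered pairs in a finite set. -/
lemma sum_sum_sub_mul_self {ι : Type*} (s : Finset ι) (x : ι → ℤ) :
    ∑ i ∈ s, ∑ j ∈ s, ((x i - x j) * (x i - x j) - 1) =
      2 * (#s * ∑ i ∈ s, x i ^ 2) - 2 * (∑ i ∈ s, x i) ^ 2 - (#s : ℤ) ^ 2 := by
  have h : ∀ i j, (x i - x j) * (x i - x j) - 1 = x i ^ 2 + x j ^ 2 - 2 * (x i * x j) - 1 :=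
    fun i j => by ring
  simp only [h, sum_sub_distrib, sum_add_distrib, sum_const, ← mul_sum, ← sum_mul, nsmul_eq_mul]
  ring

/-- The numerical core of the drift bound for unbalanced signs: `p`, `q` are the sizes of the
positive and nonpositive classes, `P`, `M` their absolute sums and `V`, `W` their sums of
squares. -/
lemma unbalanced_arith {n p q P M V W D₁ D₂ : ℝ} (hn : 0 ≤ n) (hpq : p + q = n) (hq0 : 0 ≤ q)
    (hq : 8 * q ≤ n) (hS : 2 * (P - M) ≤ n) (hp : p ≤ P) (hM : M ^ 2 ≤ q * W)
    (hV : 0 ≤ V) (hW : 0 ≤ W) (h1 : p * (W - M) ≤ 2 * D₁)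
    (h2 : 2 * (p * V) - 2 * P ^ 2 - p ^ 2 ≤ 2 * D₂) (hD₂ : 0 ≤ D₂) :
    n * (V + W) ≤ 16 * (D₁ + D₂) := by
  have hM3 : 3 * n ≤ 8 * M := by linarith
  have hqW : q * W ≤ n / 8 * W := by gcongr; linarith
  have hM2 : M ^ 2 ≤ n / 8 * W := hM.trans hqW
  have hP0 : 0 ≤ P := by linarith
  have hP : P ^ 2 ≤ (7 / 3 * M) ^ 2 := by gcongr; linarith
  have hp2 : p ^ 2 ≤ (8 / 3 * M) ^ 2 := by
    have : 0 ≤ p := by linarith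
    gcongr; linarith
  have hWM : 3 * M ≤ W := by
    rcases hn.eq_or_lt with h | h
    · subst h
      have : M ^ 2 ≤ 0 := by simpa using hM2
      have : M = 0 := by nlinarith
      linarith
    · nlinarith
  have hpV : 7 / 8 * n * V ≤ p * V := by gcongr; linarith
  have hpW : 7 / 8 * n * (2 / 3 * W) ≤ p * (W - M) := by
    have h3 : 2 / 3 * W ≤ W - M := by linarith
    have h4 : 7 / 8 * n ≤ p := by linarith
    have h5 : 0 ≤ W - M := by linarith
    have h6 : 0 ≤ p := by linarith
    gcongr
  have hnW : 0 ≤ n * W := by positivity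
  have hnV : 0 ≤ n * V := by positivity
  nlinarith

section Drift

variable {ι : Type*} [Fintype ι]

/-- The drift bound when both weak sign classes are large. -/
lemma drift_of_balanced_signs (x : ι → ℤ)
    (h1 : Fintype.card ι ≤ 8 * #{i | 0 ≤ x i}) (h2 : Fintype.card ι ≤ 8 * #{i | x i ≤ 0}) :
    (Fintype.card ι : ℤ) * ∑ i, nodePotential (x i) ≤
      16 * ∑ i, ∑ j, potentialDrop (x i) (x j) := by
  have key : ∀ i, (Fintype.card ι : ℤ) * nodePotential (x i) ≤
      16 * ∑ j, potentialDrop (x i) (x j) := by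
    intro i
    have hf := nodePotential_nonneg (x i)
    have main : ∀ s : Finset ι, Fintype.card ι ≤ 8 * #s →
        (∀ j ∈ s, nodePotential (x i) ≤ 2 * potentialDrop (x i) (x j)) →
        (Fintype.card ι : ℤ) * nodePotential (x i) ≤ 16 * ∑ j, potentialDrop (x i) (x j) := by
      intro s hs h
      have hsum : ∑ j ∈ s, potentialDrop (x i) (x j) ≤ ∑ j, potentialDrop (x i) (x j) :=
        sum_le_sum_of_subset_of_nonneg (subset_univ _) fun _ _ _ => potentialDrop_nonneg _ _
      have hlow := sum_le_sum h
      rw [sum_const, nsmul_eq_mul, ← mul_sum] at hlow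
      have hs' : (Fintype.card ι : ℤ) ≤ 8 * (#s : ℤ) := by exact_mod_cast hs
      nlinarith
    rcases le_total 0 (x i) with hi | hi
    · exact main _ h2 fun j hj => nodePotential_le (Or.inl ⟨hi, (mem_filter.1 hj).2⟩)
    · exact main _ h1 fun j hj => nodePotential_le (Or.inr ⟨hi, (mem_filter.1 hj).2⟩)
  rw [mul_sum, mul_sum]
  exact sum_le_sum fun i _ => key i

/-- The drift bound when almost all deviations are positive. -/
lemma drift_of_few_nonpos (x : ι → ℤ) (hS : 2 * ∑ i, x i ≤ Fintype.card ι)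
    (hR : 8 * #{i | x i ≤ 0} ≤ Fintype.card ι) :
    (Fintype.card ι : ℤ) * ∑ i, nodePotential (x i) ≤
      16 * ∑ i, ∑ j, potentialDrop (x i) (x j) := by
  classical
  set R : Finset ι := {i | x i ≤ 0} with hRdef
  set T : Finset ι := {i | ¬ x i ≤ 0} with hTdef
  have split : ∀ g : ι → ℤ, ∑ i ∈ R, g i + ∑ i ∈ T, g i = ∑ i, g i := fun g =>
    sum_filter_add_sum_filter_not _ _ _
  have hcard : #R + #T = Fintype.card ι := card_filter_add_card_filter_not _
  have hTx : ∀ i ∈ T, 1 ≤ x i := fun i hi => by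
    have := (mem_filter.1 hi).2
    omega
  have hRx : ∀ i ∈ R, x i ≤ 0 := fun i hi => (mem_filter.1 hi).2
  set D₁ := ∑ i ∈ R, ∑ j ∈ T, potentialDrop (x i) (x j) with hD₁
  set D₂ := ∑ i ∈ T, ∑ j ∈ T, potentialDrop (x i) (x j) with hD₂
  have hD : D₁ + D₂ ≤ ∑ i, ∑ j, potentialDrop (x i) (x j) := by
    rw [hD₁, hD₂, split fun i => ∑ j ∈ T, potentialDrop (x i) (x j)]
    exact sum_le_sum fun i _ => sum_le_sum_of_subset_of_nonneg (subset_univ _)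
      fun _ _ _ => potentialDrop_nonneg _ _
  have hD₂0 : 0 ≤ D₂ := sum_nonneg fun _ _ => sum_nonneg fun _ _ => potentialDrop_nonneg _ _
  have hRsum : ∑ i ∈ R, nodePotential (x i) = ∑ i ∈ R, x i ^ 2 - ∑ i ∈ R, -x i := by
    rw [← sum_sub_distrib]
    refine sum_congr rfl fun i hi => ?_
    rw [nodePotential, abs_of_nonpos (hRx i hi)]
    ring
  have h1 : (#T : ℤ) * (∑ i ∈ R, x i ^ 2 - ∑ i ∈ R, -x i) ≤ 2 * D₁ := by
    rw [← hRsum, hD₁, mul_sum, mul_sum]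
    refine sum_le_sum fun i hi => ?_
    rw [mul_sum, ← nsmul_eq_mul, ← sum_const]
    exact sum_le_sum fun j hj =>
      nodePotential_le (Or.inr ⟨hRx i hi, (zero_le_one.trans (hTx j hj))⟩)
  have h2 : 2 * (#T * ∑ i ∈ T, x i ^ 2) - 2 * (∑ i ∈ T, x i) ^ 2 - (#T : ℤ) ^ 2 ≤ 2 * D₂ := by
    rw [← sum_sum_sub_mul_self, hD₂, mul_sum]
    refine sum_le_sum fun i hi => ?_
    rw [mul_sum]
    exact sum_le_sum fun j hj => le_two_mul_potentialDrop_of_nonneg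
      (zero_le_one.trans (hTx i hi)) (zero_le_one.trans (hTx j hj))
  have hp : (#T : ℤ) ≤ ∑ i ∈ T, x i := by
    have := sum_le_sum hTx
    simpa using this
  have hM : (∑ i ∈ R, -x i) ^ 2 ≤ (#R : ℤ) * ∑ i ∈ R, x i ^ 2 := by
    have := sq_sum_le_card_mul_sum_sq (s := R) (f := fun i => -x i)
    simpa only [neg_sq] using this
  have hS' : 2 * (∑ i ∈ T, x i - ∑ i ∈ R, -x i) ≤ (Fintype.card ι : ℤ) := by
    rw [sum_neg_distrib, sub_neg_eq_add, add_comm, split]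
    exact hS
  have hV : 0 ≤ ∑ i ∈ T, x i ^ 2 := sum_nonneg fun _ _ => sq_nonneg _
  have hW : 0 ≤ ∑ i ∈ R, x i ^ 2 := sum_nonneg fun _ _ => sq_nonneg _
  have hle : ∑ i, nodePotential (x i) ≤ ∑ i ∈ T, x i ^ 2 + ∑ i ∈ R, x i ^ 2 := by
    rw [add_comm, split]
    refine sum_le_sum fun i _ => ?_
    rw [nodePotential, sq]
    linarith [abs_nonneg (x i)]
  have hcore : (Fintype.card ι : ℤ) * (∑ i ∈ T, x i ^ 2 + ∑ i ∈ R, x i ^ 2) ≤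
      16 * (D₁ + D₂) := by
    have := unbalanced_arith (n := Fintype.card ι) (p := #T) (q := #R)
      (P := ((∑ i ∈ T, x i : ℤ) : ℝ)) (M := ((∑ i ∈ R, -x i : ℤ) : ℝ))
      (V := ((∑ i ∈ T, x i ^ 2 : ℤ) : ℝ)) (W := ((∑ i ∈ R, x i ^ 2 : ℤ) : ℝ))
      (D₁ := D₁) (D₂ := D₂) (by positivity) (by rw [add_comm]; exact_mod_cast hcard)
      (by positivity) (by exact_mod_cast hR) (by exact_mod_cast hS') (by exact_mod_cast hp)
      (by exact_mod_cast hM) (by exact_mod_cast hV) (by exact_mod_cast hW)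
      (by exact_mod_cast h1) (by exact_mod_cast h2) (by exact_mod_cast hD₂0)
    exact_mod_cast this
  calc (Fintype.card ι : ℤ) * ∑ i, nodePotential (x i)
      ≤ Fintype.card ι * (∑ i ∈ T, x i ^ 2 + ∑ i ∈ R, x i ^ 2) := by gcongr
    _ ≤ 16 * (D₁ + D₂) := hcore
    _ ≤ _ := by gcongr

/-- If the mean deviation is at most `1/2` in absolute value, the summed potential drop over all
pairs is at least a constant times the number of nodes times the potential. -/
lemma drift (x : ι → ℤ) (hS : 2 * |∑ i, x i| ≤ Fintype.card ι) :
    (Fintype.card ι : ℤ) * ∑ i, nodePotential (x i) ≤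
      16 * ∑ i, ∑ j, potentialDrop (x i) (x j) := by
  by_cases h2 : Fintype.card ι ≤ 8 * #{i | x i ≤ 0}
  · by_cases h1 : Fintype.card ι ≤ 8 * #{i | 0 ≤ x i}
    · exact drift_of_balanced_signs x h1 h2
    · have := drift_of_few_nonpos (fun i => -x i)
        (by rw [sum_neg_distrib]; linarith [neg_abs_le (∑ i, x i)])
        (by simpa using (not_le.1 h1).le)
      simpa only [nodePotential_neg, potentialDrop_neg] using this
  · exact drift_of_few_nonpos x (by linarith [le_abs_self (∑ i, x i)]) (not_le.1 h2).le

end Drift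

lemma balance_apply {n : ℕ} (ℓ : Fin n → ℤ) (u v i : Fin n) :
    balance ℓ u v i =
      if i = u then (ℓ u + ℓ v + 1) / 2 else if i = v then (ℓ u + ℓ v) / 2 else ℓ i := by
  have hfloor : ⌊(((ℓ u + ℓ v : ℤ) : ℚ)) / 2⌋ = (ℓ u + ℓ v) / 2 := by
    exact_mod_cast Rat.floor_intCast_div_natCast (ℓ u + ℓ v) 2
  have hceil : ⌈(((ℓ u + ℓ v : ℤ) : ℚ)) / 2⌉ = (ℓ u + ℓ v + 1) / 2 := by
    have h : ⌈(((ℓ u + ℓ v : ℤ) : ℚ)) / 2⌉ = -(-(ℓ u + ℓ v) / 2) := by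
      exact_mod_cast Rat.ceil_intCast_div_natCast (ℓ u + ℓ v) 2
    omega
  rw [balance, hfloor, hceil]

lemma sum_comp_balance {n : ℕ} (g : ℤ → ℤ) (ℓ : Fin n → ℤ) {u v : Fin n} (huv : u ≠ v) :
    ∑ i, g (balance ℓ u v i) = ∑ i, g (ℓ i) -
      (g (ℓ u) + g (ℓ v) - g ((ℓ u + ℓ v + 1) / 2) - g ((ℓ u + ℓ v) / 2)) := by
  have h : ∀ i, g (balance ℓ u v i) = g (ℓ i) +
      ((if i = u then g ((ℓ u + ℓ v + 1) / 2) - g (ℓ u) else 0) +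
        (if i = v then g ((ℓ u + ℓ v) / 2) - g (ℓ v) else 0)) := by
    intro i
    rw [balance_apply]
    split_ifs with h1 h2 h2
    · exact absurd (h1.symm.trans h2) huv
    · subst h1; ring
    · subst h2; ring
    · ring
  simp only [h, sum_add_distrib, sum_ite_eq', mem_univ, if_true]
  ring

lemma sum_balance {n : ℕ} (ℓ : Fin n → ℤ) {u v : Fin n} (huv : u ≠ v) :
    ∑ i, balance ℓ u v i = ∑ i, ℓ i := by
  have := sum_comp_balance id ℓ huv
  simp only [id] at this
  omega

lemma totalPotential_balance {n : ℕ} (r : ℤ) (ℓ : Fin n → ℤ) {u v : Fin n} (huv : u ≠ v) :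
    totalPotential r (balance ℓ u v) =
      totalPotential r ℓ - potentialDrop (ℓ u - r) (ℓ v - r) := by
  have := sum_comp_balance (fun z => nodePotential (z - r)) ℓ huv
  rw [totalPotential, this, totalPotential, potentialDrop,
    show (ℓ u - r + (ℓ v - r) + 1) / 2 = (ℓ u + ℓ v + 1) / 2 - r by omega,
    show (ℓ u - r + (ℓ v - r)) / 2 = (ℓ u + ℓ v) / 2 - r by omega]

open scoped ENNReal

/-- Expectations under a bind are iterated expectations. -/
lemma PMF.tsum_bind_mul {α β : Type*} (p : PMF α) (k : α → PMF β) (F : β → ℝ≥0∞) :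
    ∑' b, p.bind k b * F b = ∑' a, p a * ∑' b, k a b * F b := by
  simp only [PMF.bind_apply, ← ENNReal.tsum_mul_right, ← ENNReal.tsum_mul_left]
  rw [ENNReal.tsum_comm]
  simp only [mul_assoc]

lemma PMF.tsum_pure_mul {α : Type*} (a : α) (F : α → ℝ≥0∞) :
    ∑' b, PMF.pure a b * F b = F a := by
  rw [tsum_eq_single a fun b hb => by simp [PMF.pure_apply, hb]]
  simp

/-- Markov's inequality for a function that is at least `1` outside `s`. -/
lemma PMF.one_le_toOuterMeasure_add {α : Type*} (p : PMF α) (s : Set α) (F : α → ℝ≥0∞)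
    (hF : ∀ a ∉ s, 1 ≤ F a) : 1 ≤ p.toOuterMeasure s + ∑' a, p a * F a := by
  rw [PMF.toOuterMeasure_apply, ← ENNReal.tsum_add, ← p.tsum_coe]
  refine ENNReal.tsum_le_tsum fun a => ?_
  by_cases ha : a ∈ s
  · simp [ha]
  · simpa [ha] using mul_le_mul_right (hF a ha) (p a)

lemma tsum_stepPMF_mul {n : ℕ} (hn : 2 ≤ n) (ℓ : Fin n → ℤ) (F : (Fin n → ℤ) → ℝ≥0∞) :
    ∑' ℓ', stepPMF hn ℓ ℓ' * F ℓ' =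
      (#{p : Fin n × Fin n | p.1 ≠ p.2} : ℝ≥0∞)⁻¹ *
        ∑ p : Fin n × Fin n with p.1 ≠ p.2, F (balance ℓ p.1 p.2) := by
  rw [stepPMF, ← PMF.bind_pure_comp, PMF.tsum_bind_mul, tsum_fintype, mul_sum, sum_filter]
  refine sum_congr rfl fun p _ => ?_
  rw [Function.comp_apply, PMF.tsum_pure_mul]
  exact (congrArg (· * _) (PMF.uniformOfFinset_apply _ p)).trans (by simp)

/-- The potential as an extended nonnegative real, set to `∞` off the vectors of total load `S`. -/
noncomputable def guardedPotential {n : ℕ} (S r : ℤ) (ℓ : Fin n → ℤ) : ℝ≥0∞ :=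
  if ∑ i, ℓ i = S then ENNReal.ofReal (totalPotential r ℓ) else ∞

lemma sum_totalPotential_balance_le {n : ℕ} (r : ℤ) (ℓ : Fin n → ℤ)
    (hS : 2 * |∑ i, (ℓ i - r)| ≤ n) (hn : 2 ≤ n) :
    ∑ p : Fin n × Fin n with p.1 ≠ p.2, (totalPotential r (balance ℓ p.1 p.2) : ℝ) ≤
      #{p : Fin n × Fin n | p.1 ≠ p.2} * ((1 - 1 / (16 * n)) * totalPotential r ℓ) := by
  set s : Finset (Fin n × Fin n) := {p | p.1 ≠ p.2} with hs
  have hcard : (#s : ℝ) ≤ n * n := by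
    have : #s ≤ n * n := (card_filter_le _ _).trans (by simp)
    exact_mod_cast this
  have hdrop : ∑ p ∈ s, potentialDrop (ℓ p.1 - r) (ℓ p.2 - r) =
      ∑ i, ∑ j, potentialDrop (ℓ i - r) (ℓ j - r) := by
    rw [← Fintype.sum_prod_type' fun i j => potentialDrop (ℓ i - r) (ℓ j - r)]
    refine sum_filter_of_ne fun p _ hp h => hp ?_
    rw [h, potentialDrop_self]
  have hdrift := drift (fun i => ℓ i - r) (by simpa using hS)
  rw [← hdrop, Fintype.card_fin] at hdrift
  have hsum : ∑ p ∈ s, totalPotential r (balance ℓ p.1 p.2) =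
      #s * totalPotential r ℓ - ∑ p ∈ s, potentialDrop (ℓ p.1 - r) (ℓ p.2 - r) := by
    rw [← nsmul_eq_mul, ← sum_const, ← sum_sub_distrib]
    exact sum_congr rfl fun p hp => totalPotential_balance r ℓ (mem_filter.1 hp).2
  have hdrift' : (n : ℝ) * totalPotential r ℓ ≤
      16 * ((∑ p ∈ s, potentialDrop (ℓ p.1 - r) (ℓ p.2 - r) : ℤ) : ℝ) := by
    exact_mod_cast hdrift
  have hsum' : ∑ p ∈ s, (totalPotential r (balance ℓ p.1 p.2) : ℝ) =
      #s * totalPotential r ℓ -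
        ((∑ p ∈ s, potentialDrop (ℓ p.1 - r) (ℓ p.2 - r) : ℤ) : ℝ) := by
    exact_mod_cast hsum
  have hΦ : (0 : ℝ) ≤ totalPotential r ℓ := by exact_mod_cast totalPotential_nonneg r ℓ
  have hn0 : (0 : ℝ) < n := by positivity
  have hfrac : (#s : ℝ) * (1 / (16 * n)) ≤ n / 16 := by
    rw [mul_one_div, div_le_div_iff₀ (by positivity) (by norm_num)]
    linarith
  have := mul_le_mul_of_nonneg_right hfrac hΦ
  rw [hsum']
  linarith

lemma tsum_stepPMF_guardedPotential_le {n : ℕ} (hn : 2 ≤ n) (S r : ℤ)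
    (hS : 2 * |S - n * r| ≤ n) (ℓ : Fin n → ℤ) :
    ∑' ℓ', stepPMF hn ℓ ℓ' * guardedPotential S r ℓ' ≤
      ENNReal.ofReal (1 - 1 / (16 * n)) * guardedPotential S r ℓ := by
  have hn' : (2 : ℝ) ≤ n := by exact_mod_cast hn
  have hρ : (0 : ℝ) < 1 - 1 / (16 * n) := by
    rw [sub_pos, div_lt_one (by positivity)]
    linarith
  by_cases hℓ : ∑ i, ℓ i = S
  · have hdev : ∑ i, (ℓ i - r) = S - n * r := by simp [hℓ]
    rw [tsum_stepPMF_mul, guardedPotential, if_pos hℓ, ← ENNReal.ofReal_mul hρ.le]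
    have hbal : ∀ p ∈ ({p | p.1 ≠ p.2} : Finset (Fin n × Fin n)),
        guardedPotential S r (balance ℓ p.1 p.2) =
          ENNReal.ofReal (totalPotential r (balance ℓ p.1 p.2)) := fun p hp => by
      rw [guardedPotential, if_pos ((sum_balance ℓ (mem_filter.1 hp).2).trans hℓ)]
    rw [sum_congr rfl hbal, ← ENNReal.ofReal_sum_of_nonneg fun p _ => by
      exact_mod_cast totalPotential_nonneg r _]
    refine (mul_le_mul_right (ENNReal.ofReal_le_ofReal
      (sum_totalPotential_balance_le r ℓ (by rwa [hdev]) hn)) _).trans ?_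
    rw [ENNReal.ofReal_mul (by positivity), ENNReal.ofReal_natCast, ← mul_assoc]
    refine mul_le_of_le_one_left zero_le (ENNReal.inv_mul_le_one _)
  · rw [guardedPotential, if_neg hℓ, ENNReal.mul_top (by simpa using hρ)]
    exact le_top

lemma tsum_iterPMF_guardedPotential_le {n : ℕ} (hn : 2 ≤ n) (S r : ℤ)
    (hS : 2 * |S - n * r| ≤ n) (ℓ0 : Fin n → ℤ) (t : ℕ) :
    ∑' ℓ, iterPMF hn ℓ0 t ℓ * guardedPotential S r ℓ ≤
      ENNReal.ofReal (1 - 1 / (16 * n)) ^ t * guardedPotential S r ℓ0 := by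
  induction t with
  | zero => simp [iterPMF]
  | succ t ih =>
    rw [iterPMF, PMF.tsum_bind_mul]
    calc _ ≤ ∑' ℓ, iterPMF hn ℓ0 t ℓ *
          (ENNReal.ofReal (1 - 1 / (16 * n)) * guardedPotential S r ℓ) :=
        ENNReal.tsum_le_tsum fun ℓ =>
          mul_le_mul_right (tsum_stepPMF_guardedPotential_le hn S r hS ℓ) _
      _ = ENNReal.ofReal (1 - 1 / (16 * n)) *
          ∑' ℓ, iterPMF hn ℓ0 t ℓ * guardedPotential S r ℓ := by
        rw [← ENNReal.tsum_mul_left]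
        simp only [mul_left_comm]
      _ ≤ _ := by
        rw [pow_succ', mul_assoc]
        gcongr

lemma one_le_guardedPotential {n : ℕ} (S r : ℤ) {ℓ : Fin n → ℤ}
    (h : ℓ ∉ {ℓ : Fin n → ℤ | ∀ i, ℓ i ∈ ({r - 1, r, r + 1} : Set ℤ)}) :
    1 ≤ guardedPotential S r ℓ := by
  rw [guardedPotential]
  split_ifs
  · simp only [Set.mem_ofPred_eq, Set.mem_insert_iff, Set.mem_singleton_iff, not_forall] at h
    obtain ⟨i, hi⟩ := h
    have hi2 : 2 ≤ |ℓ i - r| := by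
      rw [le_abs']
      omega
    have : 1 ≤ totalPotential r ℓ := (one_le_nodePotential hi2).trans
      (single_le_sum (f := fun i => nodePotential (ℓ i - r))
        (fun _ _ => nodePotential_nonneg _) (mem_univ i))
    rw [ENNReal.one_le_ofReal]
    exact_mod_cast this
  · exact le_top

lemma totalPotential_le {n : ℕ} (hn : 2 ≤ n) (ℓ : Fin n → ℤ) (r Δ : ℤ)
    (hΔ : ∀ i j, ℓ i - ℓ j ≤ Δ) (hS : 2 * |∑ i, ℓ i - n * r| ≤ n) :
    totalPotential r ℓ ≤ n * Δ ^ 2 := by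
  have hn' : (0 : ℤ) < n := by omega
  have h := abs_le.1 (show |∑ i, ℓ i - n * r| ≤ n / 2 by omega)
  have hdev : ∀ i, |ℓ i - r| ≤ Δ := by
    intro i
    have hup : ∑ j, ℓ j ≤ n * (ℓ i + Δ) := by
      have := sum_le_sum fun j (_ : j ∈ univ) => (show ℓ j ≤ ℓ i + Δ by linarith [hΔ j i])
      simpa using this
    have hlow : n * (ℓ i - Δ) ≤ ∑ j, ℓ j := by
      have := sum_le_sum fun j (_ : j ∈ univ) => (show ℓ i - Δ ≤ ℓ j by linarith [hΔ i j])
      simpa only [sum_const, card_univ, Fintype.card_fin, nsmul_eq_mul] using this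
    have hhalf : 2 * ((n : ℤ) / 2) ≤ n := by omega
    rw [abs_le]
    constructor
    · by_contra hc
      have : ℓ i + Δ + 1 ≤ r := by omega
      nlinarith
    · by_contra hc
      have : r + 1 ≤ ℓ i - Δ := by omega
      nlinarith
  have hnode : ∀ i ∈ univ, nodePotential (ℓ i - r) ≤ Δ ^ 2 := by
    intro i _
    have h1 := sq_le_sq' (by linarith [hdev i, abs_nonneg (ℓ i - r)]) (hdev i)
    rw [sq_abs] at h1
    rw [nodePotential]
    nlinarith [abs_nonneg (ℓ i - r)]
  simpa [totalPotential] using sum_le_sum hnode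

lemma decay_mul_le {n Δ : ℝ} (hn : 2 ≤ n) (hΔ : 1 ≤ Δ) :
    (1 - 1 / (16 * n)) ^ ⌈32 * n * (Real.log n + Real.log Δ)⌉₊ * (n * Δ ^ 2) ≤ 1 / n := by
  have hn0 : 0 < n := by linarith
  have hΔ0 : 0 < Δ := by linarith
  have hρ : 0 ≤ 1 - 1 / (16 * n) := by
    rw [sub_nonneg, div_le_one (by positivity)]
    linarith
  set t := ⌈32 * n * (Real.log n + Real.log Δ)⌉₊
  have ht : 32 * n * (Real.log n + Real.log Δ) ≤ t := Nat.le_ceil _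
  have hexp : (1 - 1 / (16 * n)) ^ t ≤ 1 / (n ^ 2 * Δ ^ 2) := by
    calc (1 - 1 / (16 * n)) ^ t ≤ Real.exp (-(1 / (16 * n))) ^ t := by
          gcongr
          linarith [Real.add_one_le_exp (-(1 / (16 * n)))]
      _ = Real.exp (-(t / (16 * n))) := by
          rw [← Real.exp_nat_mul]
          ring_nf
      _ ≤ Real.exp (-(Real.log (n ^ 2 * Δ ^ 2))) := by
          gcongr
          rw [Real.log_mul (by positivity) (by positivity), Real.log_pow, Real.log_pow,
            le_div_iff₀ (by positivity)]
          push_cast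
          linarith
      _ = 1 / (n ^ 2 * Δ ^ 2) := by
          rw [Real.exp_neg, Real.exp_log (by positivity), one_div]
  calc _ ≤ 1 / (n ^ 2 * Δ ^ 2) * (n * Δ ^ 2) := by gcongr
    _ = 1 / n := by field_simp

/-- **Main theorem (almost perfect balance).** There is a constant `C > 0` such that for every
`n ≥ 2` and every initial load vector `ℓ⁰ ∈ ℕⁿ` of initial discrepancy `Δ ≥ 1`, after
`⌈C·n·(log n + log Δ)⌉` steps of the balancing process the probability that every node's load
lies in `{⌊ā⌉ − 1, ⌊ā⌉, ⌊ā⌉ + 1}` is at least `1 − C/n`, where `ā = (∑ i ℓ⁰ i)/n` and `⌊ā⌉`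
is any integer at distance at most `1/2` from `ā`. -/
theorem almost_perfect_balance :
    ∃ C : ℝ, 0 < C ∧
      ∀ (n : ℕ) (hn : 2 ≤ n) (ℓ0 : Fin n → ℤ),
        (∀ i, 0 ≤ ℓ0 i) →
        ∀ Δ : ℤ,
          Δ = Finset.univ.sup' ⟨⟨0, by omega⟩, Finset.mem_univ _⟩ ℓ0
                - Finset.univ.inf' ⟨⟨0, by omega⟩, Finset.mem_univ _⟩ ℓ0 →
          1 ≤ Δ →
          ∀ r : ℤ, |((∑ i, ℓ0 i : ℤ) : ℚ) / (n : ℚ) - (r : ℚ)| ≤ 1 / 2 →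
            ENNReal.ofReal (1 - C / n) ≤
              (iterPMF hn ℓ0 ⌈C * n * (Real.log n + Real.log Δ)⌉₊).toOuterMeasure
                {ℓ | ∀ i, ℓ i ∈ ({r - 1, r, r + 1} : Set ℤ)} := by
  refine ⟨32, by norm_num, fun n hn ℓ0 _ Δ hΔ hΔ1 r hr => ?_⟩
  have hn' : (2 : ℝ) ≤ n := by exact_mod_cast hn
  have hn0 : (0 : ℝ) < n := by linarith
  have hΔ1' : (1 : ℝ) ≤ Δ := by exact_mod_cast hΔ1
  have hS : 2 * |∑ i, ℓ0 i - n * r| ≤ n := by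
    have hnq : (0 : ℚ) < n := by exact_mod_cast (by omega : 0 < n)
    have h : |((∑ i, ℓ0 i : ℤ) : ℚ) - n * r| ≤ n / 2 := by
      have := mul_le_mul_of_nonneg_left hr hnq.le
      rw [← abs_of_pos hnq, ← abs_mul, abs_of_pos hnq, mul_sub, mul_div_cancel₀ _ hnq.ne'] at this
      linarith
    have h2 : 2 * |((∑ i, ℓ0 i : ℤ) : ℚ) - n * r| ≤ n := by linarith
    exact_mod_cast h2
  have hdiff : ∀ i j, ℓ0 i - ℓ0 j ≤ Δ := fun i j => by
    rw [hΔ]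
    exact sub_le_sub (le_sup' ℓ0 (mem_univ i)) (inf'_le ℓ0 (mem_univ j))
  have hΦ : (totalPotential r ℓ0 : ℝ) ≤ n * (Δ : ℝ) ^ 2 := by
    exact_mod_cast totalPotential_le hn ℓ0 r Δ hdiff hS
  have hρ : (0 : ℝ) ≤ 1 - 1 / (16 * n) := by
    rw [sub_nonneg, div_le_one (by positivity)]
    linarith
  set t := ⌈(32 : ℝ) * n * (Real.log n + Real.log Δ)⌉₊ with ht
  have hexpect : ∑' ℓ, iterPMF hn ℓ0 t ℓ * guardedPotential (∑ i, ℓ0 i) r ℓ ≤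
      ENNReal.ofReal (32 / n) := by
    refine (tsum_iterPMF_guardedPotential_le hn _ r hS ℓ0 t).trans ?_
    rw [guardedPotential, if_pos rfl, ← ENNReal.ofReal_pow hρ,
      ← ENNReal.ofReal_mul (pow_nonneg hρ t)]
    refine ENNReal.ofReal_le_ofReal ?_
    calc _ ≤ (1 - 1 / (16 * (n : ℝ))) ^ t * (n * (Δ : ℝ) ^ 2) := by gcongr
      _ ≤ 1 / n := decay_mul_le hn' hΔ1'
      _ ≤ 32 / n := by gcongr; norm_num
  rw [ENNReal.ofReal_sub _ (by positivity), ENNReal.ofReal_one, tsub_le_iff_right]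
  exact ((iterPMF hn ℓ0 t).one_le_toOuterMeasure_add _ _
    fun _ h => one_le_guardedPotential (∑ i, ℓ0 i) r h).trans (by gcongr)
end

section
/- For all integers x, y and every real number a, the potential drop satisfies (x − a)² + (y − a)² − (⌈(x+y)/2⌉ − a)² − (⌊(x+y)/2⌋ − a)² ≥ (x − y)²/2 − 1/2. -/
/-- **Lower bound on the potential drop.** For integers `x, y` and a real `a`, the potential drop
when balancing loads `x` and `y` is at least `(x − y)²/2 − 1/2`. -/
theorem potential_drop_lower_bound (x y : ℤ) (a : ℝ) :
    ((x : ℝ) - a) ^ 2 + ((y : ℝ) - a) ^ 2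
      - ((⌈(((x + y : ℤ) : ℚ)) / 2⌉ : ℝ) - a) ^ 2
      - ((⌊(((x + y : ℤ) : ℚ)) / 2⌋ : ℝ) - a) ^ 2
      ≥ ((x : ℝ) - (y : ℝ)) ^ 2 / 2 - 1 / 2 := by
  obtain ⟨k, hk | hk⟩ := Int.even_or_odd' (x + y)
  · have hf : ⌊((x + y : ℤ) : ℚ) / 2⌋ = k := by
      rw [hk, Int.floor_eq_iff]
      push_cast
      constructor <;> linarith
    have hc : ⌈((x + y : ℤ) : ℚ) / 2⌉ = k := by
      rw [hk, Int.ceil_eq_iff]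
      push_cast
      constructor <;> linarith
    have hy : (y : ℝ) = 2 * k - x := by
      rw [eq_sub_iff_add_eq']
      exact_mod_cast hk
    rw [hf, hc, hy]
    linarith
  · have hf : ⌊((x + y : ℤ) : ℚ) / 2⌋ = k := by
      rw [hk, Int.floor_eq_iff]
      push_cast
      constructor <;> linarith
    have hc : ⌈((x + y : ℤ) : ℚ) / 2⌉ = k + 1 := by
      rw [hk, Int.ceil_eq_iff]
      push_cast
      constructor <;> linarith
    have hy : (y : ℝ) = 2 * k + 1 - x := by
      rw [eq_sub_iff_add_eq']
      exact_mod_cast hk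
    rw [hf, hc, hy]
    push_cast
    linarith
end

section
/- Let n ≥ 1, let ℓ ∈ ℤⁿ be a load vector with average ā = (∑ᵢ ℓᵢ)/n, and let m be an integer with ā ≤ m + 1/2 (e.g., m is ā rounded to the nearest integer). Let c ≥ 1 be a real number and suppose ℓᵢ ≥ m − 2c for every node i. Then the number of nodes i with ℓᵢ ≤ m is at least n/(4c + 2). -/
open scoped BigOperators

/-- **A constant fraction of nodes has load at most the rounded average.** If `ā ≤ m + 1/2`,
`c ≥ 1`, and every node has load at least `m − 2c`, then at least `n/(4c + 2)` nodes have
load at most `m`. -/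
theorem fraction_of_low_nodes (n : ℕ) (hn : 1 ≤ n) (ℓ : Fin n → ℤ) (m : ℤ) (c : ℝ)
    (hc : 1 ≤ c)
    (hm : ((∑ j, ℓ j : ℤ) : ℝ) / n ≤ (m : ℝ) + 1 / 2)
    (hlow : ∀ i, (m : ℝ) - 2 * c ≤ (ℓ i : ℝ)) :
    (n : ℝ) / (4 * c + 2) ≤
      ((Finset.univ.filter (fun i : Fin n => ℓ i ≤ m)).card : ℝ) := by
  have hn' : (0 : ℝ) < n := by exact_mod_cast hn
  have hpointwise : ∀ i, (m : ℝ) + 1 - (if ℓ i ≤ m then 2 * c + 1 else 0) ≤ (ℓ i : ℝ) := by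
    intro i
    split_ifs with h
    · linarith [hlow i]
    · have h1 : m + 1 ≤ ℓ i := by lia
      have h2 : (m : ℝ) + 1 ≤ ℓ i := by exact_mod_cast h1
      linarith
  have hsum := Finset.sum_le_sum fun i (_ : i ∈ Finset.univ) => hpointwise i
  rw [Finset.sum_sub_distrib, ← Finset.sum_filter, Finset.sum_const, Finset.sum_const,
    Finset.card_univ, Fintype.card_fin, nsmul_eq_mul, nsmul_eq_mul] at hsum
  rw [div_le_iff₀ hn'] at hm
  push_cast at hm
  rw [div_le_iff₀ (by linarith)]
  linarith
end
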